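/- arXiv:1510.03670 — 2 statements merged into one kernel-verified Lean document; each statement's English description precedes it below -/
import Mathlib

section
/- Let m be a nonnegative integer and let D ⊆ E. Then there exists a nonzero codeword c ∈ C_m with Supp(c) ⊆ D if and only if there exists a monomial x^a y^b in the sous-escalier N(In_≺(I_D)) whose weighted degree satisfies m+1 ≤ aq + b(q+1) ≤ m+q+1. -/
open MvPolynomial

noncomputable section

/-- The monomial `x^r y^s` in `F[x,y]`, where `x = X 0`, `y = X 1`. -/
def monoXY (F : Type) [Field F] (r s : ℕ) : MvPolynomial (Fin 2) F := X 0 ^ r * X 1 ^ s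

/-- The Hermitian polynomial `H = x^(q+1) - y^q - y`. -/
def Hpoly (F : Type) [Field F] (q : ℕ) : MvPolynomial (Fin 2) F :=
  X 0 ^ (q + 1) - X 1 ^ q - X 1

/-- Evaluation of a bivariate polynomial at a point of `F × F`. -/
def evalPt {F : Type} [Field F] (p : F × F) (f : MvPolynomial (Fin 2) F) : F :=
  MvPolynomial.eval ![p.1, p.2] f

/-- The vanishing ideal of a set of points `S ⊆ F × F`. -/
def vanIdeal (F : Type) [Field F] (S : Set (F × F)) : Ideal (MvPolynomial (Fin 2) F) where
  carrier := {f | ∀ p ∈ S, evalPt p f = 0}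
  add_mem' := by
    intro a b ha hb p hp
    have h1 := ha p hp
    have h2 := hb p hp
    simp only [evalPt] at h1 h2 ⊢
    simp [map_add, h1, h2]
  zero_mem' := by
    intro p hp
    simp [evalPt]
  smul_mem' := by
    intro c f hf p hp
    have h1 := hf p hp
    simp only [evalPt] at h1 ⊢
    simp [smul_eq_mul, map_mul, h1]

/-- The `DegRevLex` order with `y > x`, on exponent pairs `(a, b) ↔ x^a y^b`. -/
def precOrd : ℕ × ℕ → ℕ × ℕ → Prop := fun a b =>
  a.1 + a.2 < b.1 + b.2 ∨ (a.1 + a.2 = b.1 + b.2 ∧ a.2 < b.2)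

/-- The pair of exponents `(d 0, d 1)` of an exponent finsupp. -/
def expPair (d : Fin 2 →₀ ℕ) : ℕ × ℕ := (d 0, d 1)

/-- `x^r y^s` is the leading monomial of `f` with respect to the monomial order `lt`. -/
def IsLMwith {F : Type} [Field F] (lt : ℕ × ℕ → ℕ × ℕ → Prop)
    (f : MvPolynomial (Fin 2) F) (r s : ℕ) : Prop :=
  MvPolynomial.coeff (Finsupp.single 0 r + Finsupp.single 1 s) f ≠ 0 ∧
    ∀ d ∈ f.support, expPair d = (r, s) ∨ lt (expPair d) (r, s)

/-- The initial ideal of `I` w.r.t. the monomial order `lt`: the ideal generated by the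
leading monomials of the nonzero elements of `I`. -/
def initialIdealWith {F : Type} [Field F] (lt : ℕ × ℕ → ℕ × ℕ → Prop)
    (I : Ideal (MvPolynomial (Fin 2) F)) : Ideal (MvPolynomial (Fin 2) F) :=
  Ideal.span {g | ∃ f ∈ I, f ≠ 0 ∧ ∃ r s, IsLMwith lt f r s ∧ g = monoXY F r s}

/-- The set `E` of `F`-rational affine points of the Hermitian curve. -/
def Eset (F : Type) [Field F] (q : ℕ) : Set (F × F) :=
  {p | p.1 ^ (q + 1) = p.2 ^ q + p.2}

/-- The set `B` of (exponent pairs of) monomials. -/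
def Bset (q : ℕ) : Set (ℕ × ℕ) :=
  {p | (p.1 ≤ q ∧ p.2 ≤ q ^ 2 - q - 1) ∨ (p.1 = 0 ∧ q ^ 2 - q ≤ p.2 ∧ p.2 ≤ q ^ 2 - 1)}

/-- The Hermitian code `C_m` (as a set of vectors), for the enumeration `P` of `E`. -/
def codeSet (F : Type) [Field F] (q m : ℕ) (P : Fin (q ^ 3) → F × F) :
    Set (Fin (q ^ 3) → F) :=
  {c | ∀ r s : ℕ, r * q + s * (q + 1) ≤ m → ∑ i, c i * ((P i).1 ^ r * (P i).2 ^ s) = 0}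

/-- The weight of a codeword: the number of nonzero entries. -/
def wt {F : Type} [Field F] {n : ℕ} (c : Fin n → F) : ℕ := {i | c i ≠ 0}.ncard

/-- The support of a codeword, as a set of points of the curve. -/
def suppPts {F : Type} [Field F] {n : ℕ} (P : Fin n → F × F) (c : Fin n → F) :
    Set (F × F) :=
  P '' {i | c i ≠ 0}

end

section HermitianSousEscalier

open Finsupp (single)

lemma single_add_single_eq (d : Fin 2 →₀ ℕ) :
    Finsupp.single 0 (d 0) + Finsupp.single 1 (d 1) = d := by
  ext i; fin_cases i <;> simp

lemma monoXY_eq_monomial (F : Type) [Field F] (r s : ℕ) :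
    monoXY F r s = monomial (Finsupp.single 0 r + Finsupp.single 1 s) 1 := by
  simp [monoXY, X_pow_eq_monomial, monomial_mul]

lemma evalPt_monomial {F : Type} [Field F] (p : F × F) (d : Fin 2 →₀ ℕ) (k : F) :
    evalPt p (monomial d k) = k * (p.1 ^ d 0 * p.2 ^ d 1) := by
  simp [evalPt, eval_monomial, Finsupp.prod_fintype, Fin.prod_univ_two]

lemma precOrd_wf : WellFounded precOrd := by
  have h : WellFounded (InvImage (Prod.Lex (· < · : ℕ → ℕ → Prop) (· < · : ℕ → ℕ → Prop))
      (fun a : ℕ × ℕ => (a.1 + a.2, a.2))) :=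
    InvImage.wf _ (WellFounded.prod_lex Nat.lt_wfRel.wf Nat.lt_wfRel.wf)
  refine Subrelation.wf (fun {a b} hab => ?_) h
  simpa [InvImage, Prod.lex_def, precOrd] using hab

/-- On monomials whose `x`-exponent is at most `q`, a smaller weighted degree means a smaller
monomial. -/
lemma precOrd_of_weight_lt {q r s a b : ℕ} (hr : r ≤ q)
    (h : r * q + s * (q + 1) < a * q + b * (q + 1)) : precOrd (r, s) (a, b) := by
  by_contra hn
  simp only [precOrd, not_or, not_and, not_lt] at hn
  obtain ⟨h1, h2⟩ := hn
  rcases h1.eq_or_lt with h1 | h1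
  · have := h2 h1.symm
    nlinarith
  · nlinarith

/-- Membership of a monomial in the initial ideal means divisibility by a leading monomial. -/
lemma exists_isLM_of_mem_initialIdealWith {F : Type} [Field F] {lt : ℕ × ℕ → ℕ × ℕ → Prop}
    {I : Ideal (MvPolynomial (Fin 2) F)} {a b : ℕ} (h : monoXY F a b ∈ initialIdealWith lt I) :
    ∃ f ∈ I, ∃ r s, IsLMwith lt f r s ∧ r ≤ a ∧ s ≤ b := by
  have hset : {g | ∃ f ∈ I, f ≠ 0 ∧ ∃ r s, IsLMwith lt f r s ∧ g = monoXY F r s} =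
      (fun d => monomial d (1 : F)) ''
        {d : Fin 2 →₀ ℕ | ∃ f ∈ I, f ≠ 0 ∧ IsLMwith lt f (d 0) (d 1)} := by
    ext g
    constructor
    · rintro ⟨f, hf, h0, r, s, hLM, rfl⟩
      exact ⟨single 0 r + single 1 s, ⟨f, hf, h0, by simpa using hLM⟩,
        (monoXY_eq_monomial F r s).symm⟩
    · rintro ⟨d, ⟨f, hf, h0, hLM⟩, rfl⟩
      refine ⟨f, hf, h0, d 0, d 1, hLM, ?_⟩
      rw [monoXY_eq_monomial, single_add_single_eq]
  rw [initialIdealWith, hset, mem_ideal_span_monomial_image] at h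
  obtain ⟨d, ⟨f, hf, -, hLM⟩, hd⟩ := h (single 0 a + single 1 b) (by
    rw [monoXY_eq_monomial]; simp)
  exact ⟨f, hf, d 0, d 1, hLM, by simpa using hd 0, by simpa using hd 1⟩

lemma monoXY_mem_of_le {F : Type} [Field F] {I : Ideal (MvPolynomial (Fin 2) F)} {r s a b : ℕ}
    (h : monoXY F r s ∈ I) (hr : r ≤ a) (hs : s ≤ b) : monoXY F a b ∈ I := by
  have : monoXY F a b = monoXY F (a - r) (b - s) * monoXY F r s := by
    obtain ⟨k, rfl⟩ := Nat.exists_eq_add_of_le hr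
    obtain ⟨l, rfl⟩ := Nat.exists_eq_add_of_le hs
    simp only [monoXY, Nat.add_sub_cancel_left, pow_add]
    ring
  rw [this]
  exact I.mul_mem_left _ h

/-- The curve equation rewrites power sums with a large `x`-exponent. -/
lemma sum_monomial_reduce {F : Type} [Field F] {q : ℕ} {ι : Type*} [Fintype ι] {P : ι → F × F}
    (hP : ∀ i, P i ∈ Eset F q) (c : ι → F) (k s : ℕ) :
    ∑ i, c i * ((P i).1 ^ (k + (q + 1)) * (P i).2 ^ s) =
      ∑ i, c i * ((P i).1 ^ k * (P i).2 ^ (s + q)) +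
        ∑ i, c i * ((P i).1 ^ k * (P i).2 ^ (s + 1)) := by
  rw [← Finset.sum_add_distrib]
  refine Finset.sum_congr rfl fun i _ => ?_
  have h : (P i).1 ^ (q + 1) = (P i).2 ^ q + (P i).2 := hP i
  rw [pow_add _ k, h]
  ring

/-- Orthogonality to monomials of bounded weighted degree only has to be tested on those whose
`x`-exponent is at most `q`. -/
lemma mem_codeSet_of_reduced {F : Type} [Field F] {q m : ℕ} (hq : 1 ≤ q)
    {P : Fin (q ^ 3) → F × F} (hP : ∀ i, P i ∈ Eset F q) {c : Fin (q ^ 3) → F}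
    (h : ∀ r s : ℕ, r ≤ q → r * q + s * (q + 1) ≤ m →
      ∑ i, c i * ((P i).1 ^ r * (P i).2 ^ s) = 0) : c ∈ codeSet F q m P := by
  intro r
  induction r using Nat.strong_induction_on with
  | _ r ih =>
    intro s hs
    by_cases hr : r ≤ q
    · exact h r s hr hs
    · obtain ⟨k, rfl⟩ := Nat.exists_eq_add_of_le' (show q + 1 ≤ r by omega)
      rw [sum_monomial_reduce hP, ih k (by omega) _ (by nlinarith),
        ih k (by omega) _ (by nlinarith), add_zero]

lemma sum_mul_evalPt {F : Type} [Field F] {ι : Type*} [Fintype ι] (P : ι → F × F) (c : ι → F)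
    (f : MvPolynomial (Fin 2) F) :
    ∑ i, c i * evalPt (P i) f =
      ∑ d ∈ f.support, coeff d f * ∑ i, c i * ((P i).1 ^ d 0 * (P i).2 ^ d 1) := by
  simp_rw [Finset.mul_sum]
  rw [Finset.sum_comm]
  refine Finset.sum_congr rfl fun i _ => ?_
  rw [evalPt, eval_eq', Finset.mul_sum]
  refine Finset.sum_congr rfl fun d _ => ?_
  simp [Fin.prod_univ_two]
  ring

/-- A linear combination of point evaluations that kills the sous-escalier kills every monomial. -/
lemma sum_monomial_eq_zero {F : Type} [Field F] {ι : Type*} [Fintype ι]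
    {P : ι → F × F} {D : Set (F × F)} {c : ι → F}
    (hsupp : ∀ i, c i ≠ 0 → P i ∈ D)
    (h : ∀ a b, monoXY F a b ∉ initialIdealWith precOrd (vanIdeal F D) →
      ∑ i, c i * ((P i).1 ^ a * (P i).2 ^ b) = 0) (a b : ℕ) :
    ∑ i, c i * ((P i).1 ^ a * (P i).2 ^ b) = 0 := by
  suffices ∀ p : ℕ × ℕ, ∑ i, c i * ((P i).1 ^ p.1 * (P i).2 ^ p.2) = 0 from this (a, b)
  intro p
  induction p using precOrd_wf.induction with
  | _ p ih =>
    obtain ⟨a, b⟩ := p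
    by_cases hmem : monoXY F a b ∈ initialIdealWith precOrd (vanIdeal F D)
    swap
    · exact h a b hmem
    obtain ⟨f, hf, r, s, hLM, hr, hs⟩ := exists_isLM_of_mem_initialIdealWith hmem
    obtain ⟨k, rfl⟩ := Nat.exists_eq_add_of_le' hr
    obtain ⟨l, rfl⟩ := Nat.exists_eq_add_of_le' hs
    have h0 : ∑ i, (c i * ((P i).1 ^ k * (P i).2 ^ l)) * evalPt (P i) f = 0 := by
      refine Finset.sum_eq_zero fun i _ => ?_
      by_cases hi : c i = 0
      · simp [hi]
      · rw [hf _ (hsupp i hi), mul_zero]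
    rw [sum_mul_evalPt, Finset.sum_eq_single (single 0 r + single 1 s)] at h0
    · refine Eq.trans (Finset.sum_congr rfl fun i _ => ?_)
        ((mul_eq_zero.mp h0).resolve_left hLM.1)
      simp [pow_add]
      ring
    · intro d hd hne
      refine mul_eq_zero_of_right _ ?_
      have hlt : precOrd (d 0, d 1) (r, s) := by
        refine (hLM.2 d hd).resolve_left fun he => hne ?_
        simp only [expPair, Prod.mk.injEq] at he
        rw [← he.1, ← he.2, single_add_single_eq]
      refine Eq.trans (Finset.sum_congr rfl fun i _ => ?_) (ih (k + d 0, l + d 1) ?_)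
      · simp only [pow_add]
        ring
      · simp only [precOrd] at hlt ⊢
        omega
    · intro hn
      rw [notMem_support_iff.mp hn, zero_mul]

lemma eq_zero_of_sum_monomial_eq_zero {F : Type} [Field F] [Fintype F] {ι : Type*} [Fintype ι]
    {P : ι → F × F} (hP : Function.Injective P) {c : ι → F}
    (h : ∀ a b : ℕ, ∑ i, c i * ((P i).1 ^ a * (P i).2 ^ b) = 0) : c = 0 := by
  classical
  funext j
  have hsum : ∑ i, c i * evalPt (P i) (indicator ![(P j).1, (P j).2]) = 0 := by
    rw [sum_mul_evalPt]
    simp [h]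
  rw [Finset.sum_eq_single j] at hsum
  · simpa [evalPt, eval_indicator_apply_eq_one] using hsum
  · intro i _ hij
    rw [evalPt, eval_indicator_apply_eq_zero, mul_zero]
    intro he
    exact hij (hP (Prod.ext (congrFun he 0) (congrFun he 1)))
  · simp

/-- An element of a sous-escalier of weighted degree above `m` has a divisor whose weighted degree
lies in the window from `m + 1` to `m + q + 1`. -/
lemma exists_weight_window {F : Type} [Field F] {I : Ideal (MvPolynomial (Fin 2) F)} {q m : ℕ}
    {a b : ℕ} (h : monoXY F a b ∉ I) (hw : m + 1 ≤ a * q + b * (q + 1)) :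
    ∃ a b : ℕ, monoXY F a b ∉ I ∧ m + 1 ≤ a * q + b * (q + 1) ∧
      a * q + b * (q + 1) ≤ m + q + 1 := by
  induction hn : a + b generalizing a b with
  | zero =>
    obtain ⟨rfl, rfl⟩ : a = 0 ∧ b = 0 := by omega
    simp at hw
  | succ n ih =>
    by_cases hle : a * q + b * (q + 1) ≤ m + q + 1
    · exact ⟨a, b, h, hw, hle⟩
    rcases Nat.eq_zero_or_pos a with rfl | ha
    · obtain ⟨k, rfl⟩ := Nat.exists_eq_add_of_le' (show 1 ≤ b by omega)
      exact ih (a := 0) (b := k) (fun hk => h (monoXY_mem_of_le hk le_rfl (by omega)))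
        (by nlinarith) (by omega)
    · obtain ⟨k, rfl⟩ := Nat.exists_eq_add_of_le' ha
      exact ih (a := k) (b := b) (fun hk => h (monoXY_mem_of_le hk (by omega) le_rfl))
        (by nlinarith) (by omega)

/-- A sous-escalier monomial of weighted degree above `m` does not agree on `D` with a combination
of monomials of weighted degree at most `m` and `x`-exponent at most `q`. -/
lemma evalPt_ne_of_monoXY_notMem {F : Type} [Field F] {q m : ℕ} {D : Set (F × F)} {a b : ℕ}
    (h : monoXY F a b ∉ initialIdealWith precOrd (vanIdeal F D))
    (hw : m < a * q + b * (q + 1)) {g : MvPolynomial (Fin 2) F}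
    (hg : ∀ d ∈ g.support, d 0 ≤ q ∧ d 0 * q + d 1 * (q + 1) ≤ m) :
    ∃ p ∈ D, evalPt p g ≠ evalPt p (monoXY F a b) := by
  by_contra! hcon
  have hcoeff : coeff (single 0 a + single 1 b) (monoXY F a b - g) = 1 := by
    have : coeff (single 0 a + single 1 b) g = 0 := by
      by_contra h0
      have := (hg _ (mem_support_iff.mpr h0)).2
      simp at this
      omega
    rw [coeff_sub, this, monoXY_eq_monomial]
    simp
  refine h (Ideal.subset_span ⟨monoXY F a b - g, ?_, ?_, a, b, ⟨?_, ?_⟩, rfl⟩)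
  · intro p hp
    have := hcon p hp
    simp only [evalPt] at this ⊢
    rw [map_sub, this, sub_self]
  · rintro h0
    simp [h0] at hcoeff
  · rw [hcoeff]
    exact one_ne_zero
  · intro d hd
    by_cases hdg : d ∈ g.support
    · obtain ⟨h1, h2⟩ := hg d hdg
      exact Or.inr (precOrd_of_weight_lt h1 (by omega))
    · left
      rw [mem_support_iff, coeff_sub, notMem_support_iff.mp hdg, monoXY_eq_monomial,
        coeff_monomial, sub_zero, ne_eq, ite_eq_right_iff, Classical.not_imp] at hd
      simp [expPair, ← hd.1]

lemma exists_codeword_of_monoXY_notMem {F : Type} [Field F] {q m : ℕ} (hq : 1 ≤ q)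
    {P : Fin (q ^ 3) → F × F} (hP : ∀ p, p ∈ Set.range P ↔ p ∈ Eset F q) {D : Set (F × F)} (hD : D ⊆ Eset F q) {a b : ℕ}
    (h : monoXY F a b ∉ initialIdealWith precOrd (vanIdeal F D))
    (hw : m < a * q + b * (q + 1)) :
    ∃ c ∈ codeSet F q m P, c ≠ 0 ∧ suppPts P c ⊆ D := by
  classical
  let ev : MvPolynomial (Fin 2) F →ₗ[F] (Fin (q ^ 3) → F) :=
    { toFun := fun f i => if P i ∈ D then evalPt (P i) f else 0
      map_add' := by
        intro f g; funext i; by_cases hi : P i ∈ D <;> simp [hi, evalPt]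
      map_smul' := by
        intro k f; funext i; by_cases hi : P i ∈ D <;> simp [hi, evalPt] }
  let W : Submodule F (MvPolynomial (Fin 2) F) :=
    restrictSupport F {d | d 0 ≤ q ∧ d 0 * q + d 1 * (q + 1) ≤ m}
  have hnot : ev (monoXY F a b) ∉ W.map ev := by
    rintro ⟨g, hg, he⟩
    obtain ⟨p, hp, hne⟩ := evalPt_ne_of_monoXY_notMem h hw (g := g)
      (fun d hd => (mem_restrictSupport_iff F).mp hg hd)
    obtain ⟨i, rfl⟩ := (hP p).mpr (hD hp)
    have := congrFun he i
    simp only [ev, LinearMap.coe_mk, AddHom.coe_mk, if_pos hp] at this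
    exact hne this
  obtain ⟨φ, hφ, hker⟩ := Submodule.exists_le_ker_of_notMem hnot
  let c : Fin (q ^ 3) → F := fun i => if P i ∈ D then φ (Pi.single i 1) else 0
  have hc : ∀ f, φ (ev f) = ∑ i, c i * evalPt (P i) f := by
    intro f
    rw [LinearMap.pi_apply_eq_sum_univ φ (ev f)]
    refine Finset.sum_congr rfl fun i _ => ?_
    have hs : (fun j => if i = j then (1 : F) else 0) = Pi.single i 1 := by
      funext j; simp [Pi.single_apply, eq_comm]
    by_cases hi : P i ∈ D <;> simp [ev, c, hi, mul_comm, hs]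
  refine ⟨c, mem_codeSet_of_reduced hq (fun i => (hP _).mp ⟨i, rfl⟩) ?_, ?_, ?_⟩
  · intro r s hr hs
    have hmem : ev (monoXY F r s) ∈ W.map ev := by
      rw [monoXY_eq_monomial]
      exact Submodule.mem_map_of_mem ((monomial_mem_restrictSupport F).mpr
        (Or.inl (by simpa using ⟨hr, hs⟩)))
    have h0 := hker hmem
    rw [LinearMap.mem_ker, hc] at h0
    simpa [monoXY_eq_monomial, evalPt_monomial] using h0
  · intro h0
    exact hφ (by rw [hc, h0]; simp)
  · rintro _ ⟨i, hi, rfl⟩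
    by_contra hn
    exact hi (by simp [c, hn])

end HermitianSousEscalier

theorem stmt_6 (q : ℕ) (hq2 : 2 ≤ q) (hq : IsPrimePow q)
    (F : Type) [Field F] [Fintype F] (hF : Fintype.card F = q ^ 2)
    (P : Fin (q ^ 3) → F × F) (hPinj : Function.Injective P)
    (hPrange : Set.range P = Eset F q)
    (m : ℕ) (D : Set (F × F)) (hD : D ⊆ Eset F q) :
    (∃ c ∈ codeSet F q m P, c ≠ 0 ∧ suppPts P c ⊆ D) ↔
      ∃ a b : ℕ, monoXY F a b ∉ initialIdealWith precOrd (vanIdeal F D) ∧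
        m + 1 ≤ a * q + b * (q + 1) ∧ a * q + b * (q + 1) ≤ m + q + 1 := by
  constructor
  · rintro ⟨c, hc, hc0, hsupp⟩
    by_contra! hcon
    refine hc0 (eq_zero_of_sum_monomial_eq_zero hPinj
      (sum_monomial_eq_zero (D := D) (fun i hi => hsupp ⟨i, hi, rfl⟩) ?_))
    intro a b hab
    refine hc a b ?_
    by_contra! hlt
    obtain ⟨a', b', h1, h2, h3⟩ := exists_weight_window hab hlt
    exact absurd h3 (not_le.mpr (hcon a' b' h1 h2))
  · rintro ⟨a, b, h, hw, -⟩
    exact exists_codeword_of_monoXY_notMem (by omega) (fun p => by rw [hPrange]) hD h hw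
end

section
/- Let m ≥ q^2 - 1 be written as m = μq + β(q+1) with nonnegative integers μ ≤ q and β, and let D ⊆ E. If μ > 0, then N(In_≺(I_D)) contains a monomial of weighted degree between m+1 and m+q+1 if and only if it contains a monomial of the set L1 = {x^{μ-i} y^{β+i} : 1 ≤ i ≤ μ} ∪ {x^{q-j} y^{β+μ-q+j+1} : 0 ≤ j ≤ q-μ}. If μ = 0, then N(In_≺(I_D)) contains a monomial of weighted degree between m+1 and m+q+1 if and only if it contains a monomial of the set L2 = {x^{q-j} y^{β-q+j+1} : 0 ≤ j ≤ q}. -/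
open MvPolynomial

theorem coeff_Hpoly (F : Type) [Field F] (q : ℕ) (d : Fin 2 →₀ ℕ) :
    MvPolynomial.coeff d (Hpoly F q) =
      (if Finsupp.single 0 (q + 1) = d then 1 else 0) - (if Finsupp.single 1 q = d then 1 else 0)
        - (if Finsupp.single 1 1 = d then 1 else 0) := by
  simp [Hpoly, coeff_X_pow, coeff_X]

theorem Hpoly_mem_vanIdeal {F : Type} [Field F] {q : ℕ} {D : Set (F × F)} (hD : D ⊆ Eset F q) :
    Hpoly F q ∈ vanIdeal F D := by
  intro p hp
  have h : p.1 ^ (q + 1) = p.2 ^ q + p.2 := hD hp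
  simp [evalPt, Hpoly, h]

theorem isLMwith_precOrd_Hpoly (F : Type) [Field F] {q : ℕ} (hq : 1 ≤ q) :
    IsLMwith precOrd (Hpoly F q) (q + 1) 0 := by
  have h01 (k : ℕ) : Finsupp.single (1 : Fin 2) k ≠ Finsupp.single 0 (q + 1) := fun h => by
    simpa using DFunLike.congr_fun h 0
  refine ⟨by simp [coeff_Hpoly, h01, -Finsupp.single_add], fun d hd => ?_⟩
  rw [mem_support_iff, coeff_Hpoly] at hd
  by_cases h0 : Finsupp.single 0 (q + 1) = d
  · subst h0
    simp [expPair]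
  by_cases h1 : Finsupp.single 1 q = d
  · subst h1
    simp [expPair, precOrd]
  by_cases h2 : Finsupp.single 1 1 = d
  · subst h2
    right
    left
    simp [expPair]
    omega
  · simp [h0, h1, h2, -Finsupp.single_add] at hd

/-- Multiples of `x^(q+1)`, the leading monomial of the Hermitian polynomial, lie in the initial
ideal of every set of points of the Hermitian curve. -/
theorem monoXY_mem_initialIdealWith {F : Type} [Field F] {q : ℕ} (hq : 1 ≤ q) {D : Set (F × F)}
    (hD : D ⊆ Eset F q) {a b : ℕ} (ha : q + 1 ≤ a) :
    monoXY F a b ∈ initialIdealWith precOrd (vanIdeal F D) := by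
  have hLM := isLMwith_precOrd_Hpoly F hq
  have hH : Hpoly F q ≠ 0 := fun h => hLM.1 (by rw [h, coeff_zero])
  have hmem : monoXY F (q + 1) 0 ∈ initialIdealWith precOrd (vanIdeal F D) :=
    Ideal.subset_span ⟨_, Hpoly_mem_vanIdeal hD, hH, q + 1, 0, hLM, rfl⟩
  obtain ⟨c, rfl⟩ := Nat.exists_eq_add_of_le ha
  have hmul : monoXY F (q + 1 + c) b = monoXY F c b * monoXY F (q + 1) 0 := by
    simp only [monoXY]
    ring
  rw [hmul]
  exact Ideal.mul_mem_left _ _ hmem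

/-- Among the monomials `x^a y^b` with `a ≤ q`, those of weighted degree in the window of length
`q + 1` above that of `x^μ y^β` lie on two consecutive antidiagonals. -/
theorem weightedDegree_window_iff {q μ β a b : ℕ} (hμ : μ ≤ q) (ha : a ≤ q) :
    (μ * q + β * (q + 1) + 1 ≤ a * q + b * (q + 1) ∧
        a * q + b * (q + 1) ≤ μ * q + β * (q + 1) + q + 1) ↔
      (a + b = μ + β ∧ a < μ) ∨ (a + b = μ + β + 1 ∧ μ ≤ a) := by
  have hw (r s : ℕ) : r * q + s * (q + 1) + r = (r + s) * (q + 1) := by ring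
  have h1 := hw a b
  have h2 := hw μ β
  generalize a * q + b * (q + 1) = w at *
  generalize μ * q + β * (q + 1) = m at *
  generalize a + b = s at *
  generalize μ + β = t at *
  constructor
  · rintro ⟨hl, hu⟩
    have hs : s < t + 2 := by
      by_contra! h
      have := Nat.mul_le_mul_right (q + 1) h
      rw [add_mul] at this
      omega
    have ht : t ≤ s := by
      by_contra! h
      have := Nat.mul_le_mul_right (q + 1) (Nat.succ_le_of_lt h)
      rw [Nat.succ_mul] at this
      omega
    obtain rfl | rfl : s = t ∨ s = t + 1 := by omega
    · omega
    · rw [add_mul] at h1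
      omega
  · rintro (⟨rfl, h⟩ | ⟨rfl, h⟩)
    · omega
    · rw [add_mul] at h1
      omega

theorem stmt_7 (q : ℕ) (hq2 : 2 ≤ q) (hq : IsPrimePow q)
    (F : Type) [Field F] [Fintype F] (hF : Fintype.card F = q ^ 2)
    (m μ β : ℕ) (hm : q ^ 2 - 1 ≤ m) (hμ : μ ≤ q) (hmeq : m = μ * q + β * (q + 1))
    (D : Set (F × F)) (hD : D ⊆ Eset F q) :
    (0 < μ →
      ((∃ a b : ℕ, monoXY F a b ∉ initialIdealWith precOrd (vanIdeal F D) ∧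
          m + 1 ≤ a * q + b * (q + 1) ∧ a * q + b * (q + 1) ≤ m + q + 1) ↔
        (∃ a b : ℕ, monoXY F a b ∉ initialIdealWith precOrd (vanIdeal F D) ∧
          ((∃ i : ℕ, 1 ≤ i ∧ i ≤ μ ∧ a + i = μ ∧ b = β + i) ∨
            (∃ j : ℕ, j + μ ≤ q ∧ a + j = q ∧ b + q = β + μ + j + 1))))) ∧
    (μ = 0 →
      ((∃ a b : ℕ, monoXY F a b ∉ initialIdealWith precOrd (vanIdeal F D) ∧
          m + 1 ≤ a * q + b * (q + 1) ∧ a * q + b * (q + 1) ≤ m + q + 1) ↔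
        (∃ a b : ℕ, monoXY F a b ∉ initialIdealWith precOrd (vanIdeal F D) ∧
          ∃ j : ℕ, j ≤ q ∧ a + j = q ∧ b + q = β + j + 1))) := by
  subst hmeq
  have hN {a b : ℕ} (h : monoXY F a b ∉ initialIdealWith precOrd (vanIdeal F D)) : a ≤ q := by
    by_contra! ha
    exact h (monoXY_mem_initialIdealWith (by omega) hD ha)
  refine ⟨fun _ => ?_, fun h0 => ?_⟩
  · refine exists₂_congr fun a b => and_congr_right fun h => ?_
    rw [weightedDegree_window_iff hμ (hN h)]
    have ha := hN h
    constructor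
    · rintro (h | h)
      · exact Or.inl ⟨μ - a, by omega⟩
      · exact Or.inr ⟨q - a, by omega⟩
    · rintro (⟨i, h⟩ | ⟨j, h⟩) <;> omega
  · refine exists₂_congr fun a b => and_congr_right fun h => ?_
    rw [weightedDegree_window_iff hμ (hN h)]
    have ha := hN h
    constructor
    · intro h
      exact ⟨q - a, by omega⟩
    · rintro ⟨j, h⟩
      omega
end
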